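/- Let Z be a weight operator and let T be the smallest closed star-subalgebra of B(H) containing {Z S_i : 1 ≤ i ≤ d}. Then every X ∈ T satisfying X P_k = P_k X for all k ∈ ℕ lies in the smallest closed star-subalgebra of B(H) containing all compact operators together with the set {S_α Z^m S_β* : |α| = |β|, m ≥ 0} ∪ {S_α* Z^m S_β : |α| = |β|, m ≥ 0}. -/

import Mathlib

noncomputable section

instance (α : Type*) [DecidableEq α] : DecidableEq (FreeMonoid α) :=
  fun a b => inferInstanceAs (Decidable (a.toList = b.toList))

/-- The full Fock space of `ℂ^d`, modeled as `ℓ²` of the free monoid on `Fin d`. -/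
abbrev FockSpace (d : ℕ) : Type := lp (fun _ : FreeMonoid (Fin d) => ℂ) 2

/-- The standard basis vector `e_α` of the Fock space. -/
noncomputable def fockBasis (d : ℕ) (α : FreeMonoid (Fin d)) : FockSpace d :=
  lp.single 2 α (1 : ℂ)

/-- `S_α = S_{α₁} ⋯ S_{αₙ}` for a word `α` (with `S_∅ = 1`). -/
noncomputable def wordOp {d : ℕ} (S : Fin d → (FockSpace d →L[ℂ] FockSpace d))
    (α : FreeMonoid (Fin d)) : FockSpace d →L[ℂ] FockSpace d :=
  (α.toList.map S).prod

section StarAlgebraic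

variable {R ι : Type*} [Ring R] [StarRing R] [Algebra ℂ R] [StarModule ℂ R]

/-- If the isometries `T i` satisfy the Cuntz–Toeplitz relations modulo the two-sided ideal of a
projection `p`, compressions by `T` preserve a star algebra as soon as they map its generators
into it. -/
theorem star_mul_mul_mem_adjoin [Fintype ι] [DecidableEq ι] {G : Set R} {T : ι → R} {p : R}
    (horth : ∀ i j, star (T i) * T j = if i = j then 1 else 0)
    (hsum : ∑ i, T i * star (T i) + p = 1)
    (hp : ∀ a b, a * p * b ∈ StarAlgebra.adjoin ℂ G)
    (hG : ∀ g ∈ G, ∀ i j, star (T i) * g * T j ∈ StarAlgebra.adjoin ℂ G)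
    {x : R} (hx : x ∈ StarAlgebra.adjoin ℂ G) (i j : ι) :
    star (T i) * x * T j ∈ StarAlgebra.adjoin ℂ G := by
  induction hx using StarAlgebra.adjoin_induction generalizing i j with
  | mem g hg => exact hG g hg i j
  | algebraMap r =>
    rw [← Algebra.commutes, mul_assoc, horth]
    split_ifs
    · exact mul_mem (algebraMap_mem _ r) (one_mem _)
    · simp
  | add x y _ _ ihx ihy =>
    rw [mul_add, add_mul]
    exact add_mem (ihx i j) (ihy i j)
  | mul x y _ _ ihx ihy =>
    have key : star (T i) * (x * y) * T j
        = ∑ k, (star (T i) * x * T k) * (star (T k) * y * T j)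
          + (star (T i) * x) * p * (y * T j) := by
      calc star (T i) * (x * y) * T j
          = star (T i) * x * (∑ k, T k * star (T k) + p) * (y * T j) := by
            rw [hsum]; simp only [mul_assoc, one_mul]
        _ = _ := by
            simp only [mul_add, add_mul, Finset.mul_sum, Finset.sum_mul, mul_assoc]
    rw [key]
    exact add_mem (sum_mem fun k _ => mul_mem (ihx i k) (ihy k j)) (hp _ _)
  | star x _ ih => simpa [mul_assoc] using star_mem (ih j i)

/-- Amplification by isometries `T` with orthogonal ranges preserves a star algebra as soon as it
maps its generators and the unit into it. -/
theorem mul_mul_star_mem_adjoin [DecidableEq ι] {G : Set R} {T : ι → R}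
    (horth : ∀ i j, star (T i) * T j = if i = j then 1 else 0)
    (hT : ∀ i j, T i * star (T j) ∈ StarAlgebra.adjoin ℂ G)
    (hG : ∀ g ∈ G, ∀ i j, T i * g * star (T j) ∈ StarAlgebra.adjoin ℂ G)
    {x : R} (hx : x ∈ StarAlgebra.adjoin ℂ G) (i j : ι) :
    T i * x * star (T j) ∈ StarAlgebra.adjoin ℂ G := by
  induction hx using StarAlgebra.adjoin_induction generalizing i j with
  | mem g hg => exact hG g hg i j
  | algebraMap r =>
    rw [← Algebra.commutes, mul_assoc]
    exact mul_mem (algebraMap_mem _ r) (hT i j)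
  | add x y _ _ ihx ihy =>
    rw [mul_add, add_mul]
    exact add_mem (ihx i j) (ihy i j)
  | mul x y _ _ ihx ihy =>
    have key : T i * (x * y) * star (T j)
        = (T i * x * star (T i)) * (T i * y * star (T j)) := by
      calc T i * (x * y) * star (T j)
          = T i * x * (star (T i) * T i) * (y * star (T j)) := by
            rw [horth]; simp [mul_assoc]
        _ = _ := by simp only [mul_assoc]
    rw [key]
    exact mul_mem (ihx i i) (ihy i j)
  | star x _ ih => simpa [mul_assoc] using star_mem (ih j i)

/-- A star algebra generated by `Z * T i` is spanned by the elements `a * T k ^ n` and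
`star (T k) ^ n * a`, for any fixed `k`, with `a` in a star algebra that contains `Z` and is
stable under `T i * · * star (T j)` and `star (T i) * · * T j`. -/
theorem adjoin_range_mul_le_span {T : ι → R} {Z : R} {A : StarSubalgebra ℂ R} (hZ : Z ∈ A) (k : ι)
    (hk : star (T k) * T k = 1)
    (hin : ∀ a ∈ A, ∀ i j, star (T i) * a * T j ∈ A)
    (hout : ∀ a ∈ A, ∀ i j, T i * a * star (T j) ∈ A)
    {x : R} (hx : x ∈ StarAlgebra.adjoin ℂ (Set.range fun i => Z * T i)) :
    x ∈ Submodule.span ℂ ({y | ∃ a ∈ A, ∃ n : ℕ, y = a * T k ^ n} ∪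
      {y | ∃ a ∈ A, ∃ n : ℕ, y = star (T k) ^ n * a}) := by
  set M := Submodule.span ℂ ({y | ∃ a ∈ A, ∃ n : ℕ, y = a * T k ^ n} ∪
      {y | ∃ a ∈ A, ∃ n : ℕ, y = star (T k) ^ n * a})
  have memr : ∀ a ∈ A, ∀ n : ℕ, a * T k ^ n ∈ M := fun a ha n =>
    Submodule.subset_span (Or.inl ⟨a, ha, n, rfl⟩)
  have meml : ∀ a ∈ A, ∀ n : ℕ, star (T k) ^ n * a ∈ M := fun a ha n =>
    Submodule.subset_span (Or.inr ⟨a, ha, n, rfl⟩)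
  have hkn : ∀ n : ℕ, star (T k) ^ n * T k ^ n = 1 := fun n => by
    induction n with
    | zero => simp
    | succ n ih =>
      rw [pow_succ, pow_succ', mul_assoc, ← mul_assoc (star (T k)) (T k), hk, one_mul, ih]
  have houtn : ∀ (n : ℕ), ∀ a ∈ A, T k ^ n * a * star (T k) ^ n ∈ A := fun n => by
    induction n with
    | zero => simp
    | succ n ih =>
      intro a ha
      have := hout _ (ih a ha) k k
      rw [pow_succ', pow_succ]
      simpa only [mul_assoc] using this
  have comm : ∀ (n : ℕ) (c : R), c * star (T k) ^ n
      = star (T k) ^ n * (T k ^ n * c * star (T k) ^ n) := fun n c => by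
    rw [mul_assoc, ← mul_assoc (star (T k) ^ n), hkn, one_mul]
  have hone : ∀ i j, T i * star (T j) ∈ A := fun i j => by simpa using hout 1 (one_mem A) i j
  have up : ∀ i, ∀ m ∈ M, Z * T i * m ∈ M := by
    intro i m hm
    induction hm using Submodule.span_induction with
    | zero => simp
    | add x y _ _ hx hy => rw [mul_add]; exact add_mem hx hy
    | smul c x _ hx => rw [mul_smul_comm]; exact M.smul_mem c hx
    | mem x hx =>
      have right : ∀ a ∈ A, ∀ n : ℕ, Z * T i * (a * T k ^ n) ∈ M := fun a ha n => by
        have : Z * T i * (a * T k ^ n) = Z * (T i * a * star (T k)) * T k ^ (n + 1) := by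
          rw [pow_succ']
          calc _ = Z * T i * a * 1 * T k ^ n := by simp only [mul_assoc, one_mul]
            _ = _ := by rw [← hk]; simp only [mul_assoc]
        rw [this]
        exact memr _ (mul_mem hZ (hout a ha i k)) _
      rcases hx with ⟨a, ha, n, rfl⟩ | ⟨a, ha, n, rfl⟩
      · exact right a ha n
      · cases n with
        | zero => simpa using right a ha 0
        | succ n =>
          have : Z * T i * (star (T k) ^ (n + 1) * a)
              = star (T k) ^ n * (T k ^ n * (Z * (T i * star (T k))) * star (T k) ^ n * a) := by
            rw [← mul_assoc (star (T k) ^ n), ← comm, pow_succ']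
            simp only [mul_assoc]
          rw [this]
          exact meml _ (mul_mem (houtn n _ (mul_mem hZ (hone i k))) ha) _
  have down : ∀ i, ∀ m ∈ M, star (Z * T i) * m ∈ M := by
    intro i m hm
    induction hm using Submodule.span_induction with
    | zero => simp
    | add x y _ _ hx hy => rw [mul_add]; exact add_mem hx hy
    | smul c x _ hx => rw [mul_smul_comm]; exact M.smul_mem c hx
    | mem x hx =>
      have left : ∀ a ∈ A, ∀ n : ℕ, star (Z * T i) * (star (T k) ^ n * a) ∈ M := fun a ha n => by
        have : star (Z * T i) * (star (T k) ^ n * a) = star (T k) ^ (n + 1) *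
            (T k ^ n * (T k * star (T i) * star Z) * star (T k) ^ n * a) := by
          calc _ = star (T k) * T k * (star (T i) * star Z) * star (T k) ^ n * a := by
                rw [hk, one_mul, star_mul]; simp only [mul_assoc]
            _ = star (T k) * ((T k * star (T i) * star Z) * star (T k) ^ n) * a := by
                simp only [mul_assoc]
            _ = _ := by rw [comm, pow_succ']; simp only [mul_assoc]
        rw [this]
        exact meml _ (mul_mem (houtn n _ (mul_mem (hone k i) (star_mem hZ))) ha) _
      rcases hx with ⟨a, ha, n, rfl⟩ | ⟨a, ha, n, rfl⟩
      · cases n with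
        | zero => simpa using left a ha 0
        | succ n =>
          have : star (Z * T i) * (a * T k ^ (n + 1))
              = (star (T i) * (star Z * a) * T k) * T k ^ n := by
            rw [pow_succ', star_mul]; simp only [mul_assoc]
          rw [this]
          exact memr _ (hin _ (mul_mem (star_mem hZ) ha) i k) _
      · exact left a ha n
  have key : ∀ m ∈ M, x * m ∈ M := by
    change x ∈ Algebra.adjoin ℂ _ at hx
    induction hx using Algebra.adjoin_induction with
    | mem x hx =>
      rcases hx with ⟨i, rfl⟩ | ⟨i, hi⟩
      · exact up i
      · rw [← star_star x, ← hi]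
        exact down i
    | algebraMap r =>
      intro m hm
      rw [← Algebra.smul_def]
      exact M.smul_mem r hm
    | add x y _ _ hx hy =>
      intro m hm
      rw [add_mul]
      exact add_mem (hx m hm) (hy m hm)
    | mul x y _ _ hx hy =>
      intro m hm
      rw [mul_assoc]
      exact hx _ (hy m hm)
  simpa using key 1 (by simpa using memr 1 (one_mem A) 0)

/-- For a grading by orthogonal idempotents `P n`, elements of the span of `a * s ^ n` and
`star s ^ n * a` with `a` in a diagonal algebra have diagonal part in that algebra. -/
theorem exists_diagonal_part {A : StarSubalgebra ℂ R} {P : ℕ → R} {s : R}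
    (hPA : ∀ a ∈ A, ∀ n, a * P n = P n * a)
    (hP : ∀ m n, P m * P n = if m = n then P n else 0)
    (hs : ∀ n, P (n + 1) * s = s * P n) (hs0 : P 0 * s = 0)
    (hPstar : ∀ n, star (P n) = P n) {x : R}
    (hx : x ∈ Submodule.span ℂ ({y | ∃ a ∈ A, ∃ n : ℕ, y = a * s ^ n} ∪
      {y | ∃ a ∈ A, ∃ n : ℕ, y = star s ^ n * a})) :
    ∃ a ∈ A, ∀ n, P n * (x - a) * P n = 0 := by
  have hshift : ∀ n m, P (m + n) * s ^ n = s ^ n * P m := fun n => by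
    induction n with
    | zero => simp
    | succ n ih =>
      intro m
      rw [pow_succ', ← mul_assoc, ← add_assoc, hs, mul_assoc, ih, mul_assoc]
  have hlow : ∀ n m, m < n → P m * s ^ n = 0 := fun n => by
    induction n with
    | zero => simp
    | succ n ih =>
      intro m hm
      rw [pow_succ', ← mul_assoc]
      cases m with
      | zero => rw [hs0, zero_mul]
      | succ m => rw [hs, mul_assoc, ih m (by omega), mul_zero]
  have hoff : ∀ n m, n ≠ 0 → P m * s ^ n * P m = 0 := fun n m hn => by
    rcases lt_or_ge m n with h | h
    · rw [hlow n m h, zero_mul]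
    · obtain ⟨l, rfl⟩ := Nat.exists_eq_add_of_le' h
      rw [hshift, mul_assoc, hP, if_neg (by omega), mul_zero]
  induction hx using Submodule.span_induction with
  | zero => exact ⟨0, zero_mem A, by simp⟩
  | add x y _ _ hx hy =>
    obtain ⟨a, ha, hxa⟩ := hx
    obtain ⟨b, hb, hyb⟩ := hy
    refine ⟨a + b, add_mem ha hb, fun n => ?_⟩
    rw [add_sub_add_comm, mul_add, add_mul, hxa, hyb, add_zero]
  | smul c x _ hx =>
    obtain ⟨a, ha, hxa⟩ := hx
    refine ⟨c • a, A.smul_mem ha c, fun n => ?_⟩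
    rw [← smul_sub, mul_smul_comm, smul_mul_assoc, hxa, smul_zero]
  | mem x hx =>
    rcases hx with ⟨a, ha, n, rfl⟩ | ⟨a, ha, n, rfl⟩ <;> rcases eq_or_ne n 0 with rfl | hn
    · exact ⟨a, ha, by simp⟩
    · refine ⟨0, zero_mem A, fun m => ?_⟩
      rw [sub_zero, ← mul_assoc, ← hPA a ha, mul_assoc, mul_assoc, ← mul_assoc (P m), hoff n m hn,
        mul_zero]
    · exact ⟨a, ha, by simp⟩
    · refine ⟨0, zero_mem A, fun m => ?_⟩
      have h := congrArg star (hoff n m hn)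
      simp only [star_mul, star_pow, hPstar, star_zero] at h
      rw [sub_zero, mul_assoc, mul_assoc, hPA a ha, ← mul_assoc, ← mul_assoc, mul_assoc (P m), h,
        zero_mul]

end StarAlgebraic

section Fock

variable {d : ℕ}

theorem inner_fockBasis_left (α : FreeMonoid (Fin d)) (x : FockSpace d) :
    inner ℂ (fockBasis d α) x = x α := by
  simp [fockBasis, lp.inner_single_left]

theorem fockBasis_apply (α β : FreeMonoid (Fin d)) :
    fockBasis d α β = if α = β then 1 else 0 := by
  rw [fockBasis, lp.coeFn_single, Pi.single_apply]
  simp only [eq_comm]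

theorem norm_fockBasis (α : FreeMonoid (Fin d)) : ‖fockBasis d α‖ = 1 := by
  rw [fockBasis, lp.norm_single (by norm_num), norm_one]

theorem ext_fockBasis {A B : FockSpace d →L[ℂ] FockSpace d}
    (h : ∀ α, A (fockBasis d α) = B (fockBasis d α)) : A = B := by
  ext1 x
  have hx := lp.hasSum_single (p := 2) (by norm_num) x
  have hsmul : ∀ α, lp.single 2 α (x α) = x α • fockBasis d α := fun α => by
    rw [fockBasis, ← lp.single_smul, smul_eq_mul, mul_one]
  simp only [hsmul] at hx
  refine (hx.mapL A).unique ?_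
  convert! hx.mapL B using 2 with α
  simp [h]

theorem ext_inner_fockBasis {A B : FockSpace d →L[ℂ] FockSpace d}
    (h : ∀ α β, inner ℂ (fockBasis d α) (A (fockBasis d β))
      = inner ℂ (fockBasis d α) (B (fockBasis d β))) : A = B := by
  refine ext_fockBasis fun β => ?_
  ext α
  simpa only [inner_fockBasis_left] using h α β

/-- `P k` is the orthogonal projection onto the span of the `e_α` with `|α| = k`. -/
abbrev IsGrading (P : ℕ → (FockSpace d →L[ℂ] FockSpace d)) : Prop :=
  ∀ (k : ℕ) (α : FreeMonoid (Fin d)),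
    P k (fockBasis d α) = if α.length = k then fockBasis d α else 0

/-- `S i` is the creation operator `e_α ↦ e_{iα}`. -/
abbrev IsCreation (S : Fin d → (FockSpace d →L[ℂ] FockSpace d)) : Prop :=
  ∀ (i : Fin d) (α : FreeMonoid (Fin d)),
    S i (fockBasis d α) = fockBasis d (FreeMonoid.of i * α)

section Grading

variable {P : ℕ → (FockSpace d →L[ℂ] FockSpace d)}

theorem star_grading (hP : IsGrading P) (k : ℕ) : star (P k) = P k := by
  refine ext_inner_fockBasis fun α β => ?_
  rw [ContinuousLinearMap.star_eq_adjoint, ContinuousLinearMap.adjoint_inner_right, hP, hP]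
  by_cases h : α = β
  · subst h
    split_ifs <;> simp
  · split_ifs <;> simp [inner_fockBasis_left, fockBasis_apply, Ne.symm h]

theorem grading_apply (hP : IsGrading P) (k : ℕ) (x : FockSpace d) (α : FreeMonoid (Fin d)) :
    P k x α = if α.length = k then x α else 0 := by
  rw [← inner_fockBasis_left, ← star_grading hP, ContinuousLinearMap.star_eq_adjoint,
    ContinuousLinearMap.adjoint_inner_right, hP]
  split_ifs <;> simp [inner_fockBasis_left]

theorem grading_mul_grading (hP : IsGrading P) (m n : ℕ) :
    P m * P n = if m = n then P n else 0 := by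
  refine ext_fockBasis fun α => ?_
  rw [mul_apply_eq_comp, hP]
  split_ifs with h1 h2 h2
  · rw [hP, hP, h2]
  · rw [hP, if_neg (by omega)]; rfl
  · rw [map_zero, hP, if_neg h1]
  · simp

theorem hasSum_norm_grading_sq (hP : IsGrading P) (x : FockSpace d) :
    HasSum (fun k => ‖P k x‖ ^ 2) (‖x‖ ^ 2) := by
  have hnorm : ∀ y : FockSpace d, HasSum (fun α => ‖y α‖ ^ 2) (‖y‖ ^ 2) := fun y => by
    simpa using lp.hasSum_norm (p := 2) (by norm_num) y
  have h := (hnorm x).tsum_fiberwise (fun α => α.length)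
  convert! h using 2 with k
  rw [← (hnorm (P k x)).tsum_eq, tsum_subtype (_ ⁻¹' {k}) (fun α => ‖x α‖ ^ 2)]
  refine tsum_congr fun α => ?_
  rw [grading_apply hP]
  by_cases hk : α.length = k <;> simp [Set.indicator, hk]

theorem norm_le_of_grading (hP : IsGrading P)
    {B : FockSpace d →L[ℂ] FockSpace d} (hB : ∀ k, B * P k = P k * B)
    {ε : ℝ} (hε : 0 ≤ ε) (h : ∀ k, ‖P k * B * P k‖ ≤ ε) : ‖B‖ ≤ ε := by
  refine B.opNorm_le_bound hε fun x => ?_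
  refine le_of_sq_le_sq ?_ (by positivity)
  rw [mul_pow]
  refine hasSum_le (fun k => ?_) (hasSum_norm_grading_sq hP (B x))
    ((hasSum_norm_grading_sq hP x).mul_left (ε ^ 2))
  have hPB : P k (B x) = (P k * B * P k) (P k x) := by
    have : P k * B = P k * B * P k * P k := by
      rw [mul_assoc (P k * B), grading_mul_grading hP, if_pos rfl, mul_assoc, hB, ← mul_assoc,
        grading_mul_grading hP, if_pos rfl]
    exact DFunLike.congr_fun this x
  rw [hPB, ← mul_pow]
  gcongr
  exact (P k * B * P k).le_of_opNorm_le (h k) _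

theorem norm_grading_le_one (hP : IsGrading P) (k : ℕ) : ‖P k‖ ≤ 1 := by
  refine (P k).opNorm_le_bound zero_le_one fun x => ?_
  rw [one_mul]
  refine le_of_sq_le_sq ?_ (norm_nonneg x)
  exact le_hasSum (hasSum_norm_grading_sq hP x) k fun _ _ => by positivity

theorem isCompactOperator_grading_zero (hP : IsGrading P) : IsCompactOperator (P 0) := by
  have h : P 0 = (ContinuousLinearMap.toSpanSingleton ℂ (fockBasis d 1)).comp
      (innerSL ℂ (fockBasis d 1)) := by
    refine ext_fockBasis fun α => ?_
    rw [hP]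
    by_cases h1 : α = 1
    · subst h1
      simp [norm_fockBasis]
    · have : α.length ≠ 0 := fun h => h1 (FreeMonoid.length_eq_zero.mp h)
      simp [inner_fockBasis_left, fockBasis_apply, h1, this]
  rw [h]
  exact (isCompactOperator_of_locallyCompactSpace_dom (innerSL ℂ (fockBasis d 1))).clm_comp
    (ContinuousLinearMap.toSpanSingleton ℂ (fockBasis d 1))

end Grading

section Creation

variable {S : Fin d → (FockSpace d →L[ℂ] FockSpace d)}

theorem star_creation_mul (hS : IsCreation S) (i j : Fin d) :
    star (S i) * S j = if i = j then 1 else 0 := by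
  refine ext_inner_fockBasis fun α β => ?_
  rw [ContinuousLinearMap.star_eq_adjoint, mul_apply_eq_comp,
    ContinuousLinearMap.adjoint_inner_right, hS, hS, inner_fockBasis_left, fockBasis_apply]
  have key : FreeMonoid.of j * β = FreeMonoid.of i * α ↔ j = i ∧ β = α := List.cons.injEq .. |>.to_iff
  split_ifs <;> simp_all [inner_fockBasis_left, fockBasis_apply, norm_fockBasis]

theorem star_creation_vacuum (hS : IsCreation S) (i : Fin d) : star (S i) (fockBasis d 1) = 0 := by
  ext α
  rw [← inner_fockBasis_left, ContinuousLinearMap.star_eq_adjoint,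
    ContinuousLinearMap.adjoint_inner_right, hS, inner_fockBasis_left, fockBasis_apply, if_neg]
  · rfl
  · exact fun h => List.cons_ne_nil _ _ h.symm

variable {P : ℕ → (FockSpace d →L[ℂ] FockSpace d)}

theorem sum_creation_mul_star (hS : IsCreation S) (hP : IsGrading P) :
    ∑ i, S i * star (S i) + P 0 = 1 := by
  refine ext_fockBasis fun α => ?_
  rw [add_apply, sum_apply, hP]
  simp only [mul_apply_eq_comp]
  induction α using FreeMonoid.casesOn with
  | one => simp [star_creation_vacuum hS]
  | of_mul j β =>
    have h : ∀ i, star (S i) (fockBasis d (FreeMonoid.of j * β))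
        = if i = j then fockBasis d β else 0 := fun i => by
      rw [← hS, ← mul_apply_eq_comp, star_creation_mul hS]
      split_ifs <;> rfl
    rw [Finset.sum_eq_single j]
    · simp [h, hS]
    · intro i _ hij
      simp [h, hij]
    · simp

theorem grading_succ_mul_creation (hS : IsCreation S) (hP : IsGrading P) (k : ℕ) (i : Fin d) :
    P (k + 1) * S i = S i * P k := by
  refine ext_fockBasis fun α => ?_
  rw [mul_apply_eq_comp, mul_apply_eq_comp, hS, hP, hP,
    FreeMonoid.length_mul, FreeMonoid.length_of]
  by_cases h : α.length = k
  · rw [if_pos (by omega), if_pos h, hS]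
  · rw [if_neg (by omega), if_neg h, map_zero]

theorem grading_zero_mul_creation (hS : IsCreation S) (hP : IsGrading P) (i : Fin d) :
    P 0 * S i = 0 := by
  refine ext_fockBasis fun α => ?_
  rw [mul_apply_eq_comp, hS, hP, FreeMonoid.length_mul, FreeMonoid.length_of,
    if_neg (by omega)]
  rfl

theorem star_creation_mul_grading_succ (hS : IsCreation S) (hP : IsGrading P) (k : ℕ) (i : Fin d) :
    star (S i) * P (k + 1) = P k * star (S i) := by
  simpa [star_grading hP] using congrArg star (grading_succ_mul_creation hS hP k i)

theorem star_creation_mul_grading_zero (hS : IsCreation S) (hP : IsGrading P) (i : Fin d) :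
    star (S i) * P 0 = 0 := by
  simpa [star_grading hP] using congrArg star (grading_zero_mul_creation hS hP i)

theorem star_creation_mul_mul_commute (hS : IsCreation S) (hP : IsGrading P)
    {a : FockSpace d →L[ℂ] FockSpace d}
    (ha : ∀ k, a * P k = P k * a) (i j : Fin d) (k : ℕ) :
    (star (S i) * a * S j) * P k = P k * (star (S i) * a * S j) := by
  rw [mul_assoc, ← grading_succ_mul_creation hS hP, ← mul_assoc, mul_assoc (star _), ha,
    ← mul_assoc, star_creation_mul_grading_succ hS hP]
  simp only [mul_assoc]

theorem creation_mul_mul_star_commute (hS : IsCreation S) (hP : IsGrading P)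
    {a : FockSpace d →L[ℂ] FockSpace d}
    (ha : ∀ k, a * P k = P k * a) (i j : Fin d) (k : ℕ) :
    (S i * a * star (S j)) * P k = P k * (S i * a * star (S j)) := by
  cases k with
  | zero =>
    rw [mul_assoc, star_creation_mul_grading_zero hS hP, mul_zero, ← mul_assoc, ← mul_assoc,
      grading_zero_mul_creation hS hP, zero_mul, zero_mul]
  | succ k =>
    rw [mul_assoc, star_creation_mul_grading_succ hS hP, ← mul_assoc, mul_assoc (S i), ha,
      ← mul_assoc, ← grading_succ_mul_creation hS hP]
    simp only [mul_assoc]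

end Creation

theorem wordOp_mul (S : Fin d → (FockSpace d →L[ℂ] FockSpace d)) (α β : FreeMonoid (Fin d)) :
    wordOp S (α * β) = wordOp S α * wordOp S β := by
  simp [wordOp]

theorem wordOp_of (S : Fin d → (FockSpace d →L[ℂ] FockSpace d)) (i : Fin d) :
    wordOp S (FreeMonoid.of i) = S i := by
  simp [wordOp]

theorem wordOp_one (S : Fin d → (FockSpace d →L[ℂ] FockSpace d)) :
    wordOp S 1 = 1 := by
  simp [wordOp]

theorem exists_eq_mul_of_length_eq {α β : FreeMonoid (Fin d)} (h : α.length = β.length) :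
    (α = 1 ∧ β = 1) ∨ (∃ i α' j β', α = FreeMonoid.of i * α' ∧ β = FreeMonoid.of j * β' ∧
      α'.length = β'.length) := by
  induction α using FreeMonoid.casesOn with
  | one => exact Or.inl ⟨rfl, FreeMonoid.length_eq_zero.mp h.symm⟩
  | of_mul i α =>
    induction β using FreeMonoid.casesOn with
    | one => simp at h
    | of_mul j β => exact Or.inr ⟨i, α, j, β, rfl, rfl, by simpa using h⟩

theorem exists_eq_mul_of_length_eq' {α β : FreeMonoid (Fin d)} (h : α.length = β.length) :
    (α = 1 ∧ β = 1) ∨ (∃ α' i β' j, α = α' * FreeMonoid.of i ∧ β = β' * FreeMonoid.of j ∧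
      α'.length = β'.length) := by
  rcases exists_eq_mul_of_length_eq (α := α.reverse) (β := β.reverse) (by simpa using h) with
    ⟨h1, h2⟩ | ⟨i, α', j, β', h1, h2, h3⟩
  · left
    rw [← FreeMonoid.length_eq_zero] at h1 h2
    simpa using And.intro h1 h2
  · right
    refine ⟨α'.reverse, i, β'.reverse, j, ?_, ?_, by simpa using h3⟩
    · rw [← α.reverse_reverse, h1, FreeMonoid.reverse_mul]; rfl
    · rw [← β.reverse_reverse, h2, FreeMonoid.reverse_mul]; rfl

end Fock

open ContinuousLinearMap in
theorem statement8 (d : ℕ) (hd : 1 ≤ d)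
    (S : Fin d → (FockSpace d →L[ℂ] FockSpace d))
    (hS : ∀ (i : Fin d) (α : FreeMonoid (Fin d)),
      S i (fockBasis d α) = fockBasis d (FreeMonoid.of i * α))
    (P : ℕ → (FockSpace d →L[ℂ] FockSpace d))
    (hP : ∀ (k : ℕ) (α : FreeMonoid (Fin d)),
      P k (fockBasis d α) = if α.length = k then fockBasis d α else 0)
    (Z : FockSpace d →L[ℂ] FockSpace d)
    (hZinv : IsUnit Z)
    (hZP : ∀ k : ℕ, Z * P k = P k * Z)
    (hZ0 : Z * P 0 = P 0)
    (X : FockSpace d →L[ℂ] FockSpace d)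
    (hXT : X ∈ (StarAlgebra.adjoin ℂ (Set.range fun i => Z * S i)).topologicalClosure)
    (hXD : ∀ k : ℕ, X * P k = P k * X) :
    X ∈ (StarAlgebra.adjoin ℂ
      ({Y : FockSpace d →L[ℂ] FockSpace d | IsCompactOperator ⇑Y} ∪
        {x | ∃ (α β : FreeMonoid (Fin d)) (m : ℕ), α.length = β.length ∧
          x = wordOp S α * Z ^ m * adjoint (wordOp S β)} ∪
        {x | ∃ (α β : FreeMonoid (Fin d)) (m : ℕ), α.length = β.length ∧
          x = adjoint (wordOp S α) * Z ^ m * wordOp S β})).topologicalClosure := by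
  set G : Set (FockSpace d →L[ℂ] FockSpace d) :=
    {Y : FockSpace d →L[ℂ] FockSpace d | IsCompactOperator ⇑Y} ∪
        {x | ∃ (α β : FreeMonoid (Fin d)) (m : ℕ), α.length = β.length ∧
          x = wordOp S α * Z ^ m * adjoint (wordOp S β)} ∪
        {x | ∃ (α β : FreeMonoid (Fin d)) (m : ℕ), α.length = β.length ∧
          x = adjoint (wordOp S α) * Z ^ m * wordOp S β}
  have hcpt : ∀ K : FockSpace d →L[ℂ] FockSpace d, IsCompactOperator K →
      K ∈ StarAlgebra.adjoin ℂ G := fun K hK =>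
    StarAlgebra.subset_adjoin ℂ G (Or.inl (Or.inl hK))
  have hout : ∀ (α β : FreeMonoid (Fin d)) (m : ℕ), α.length = β.length →
      wordOp S α * Z ^ m * star (wordOp S β) ∈ StarAlgebra.adjoin ℂ G := fun α β m h =>
    StarAlgebra.subset_adjoin ℂ G (Or.inl (Or.inr ⟨α, β, m, h, rfl⟩))
  have hin : ∀ (α β : FreeMonoid (Fin d)) (m : ℕ), α.length = β.length →
      star (wordOp S α) * Z ^ m * wordOp S β ∈ StarAlgebra.adjoin ℂ G := fun α β m h =>
    StarAlgebra.subset_adjoin ℂ G (Or.inr ⟨α, β, m, h, rfl⟩)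
  have horth := star_creation_mul hS
  have hone : ∀ i j, S i * star (S j) ∈ StarAlgebra.adjoin ℂ G := fun i j => by
    simpa [wordOp_of] using hout (FreeMonoid.of i) (FreeMonoid.of j) 0 rfl
  have hstable_in : ∀ x ∈ StarAlgebra.adjoin ℂ G, ∀ i j,
      star (S i) * x * S j ∈ StarAlgebra.adjoin ℂ G := fun x hx =>
    star_mul_mul_mem_adjoin horth (sum_creation_mul_star hS hP)
      (fun a b => hcpt _ (((isCompactOperator_grading_zero hP).clm_comp a).comp_clm b))
      (by
        rintro g ((hg | ⟨α, β, m, h, rfl⟩) | ⟨α, β, m, h, rfl⟩) i j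
        · exact hcpt _ ((IsCompactOperator.clm_comp hg (star (S i))).comp_clm (S j))
        · rw [← star_eq_adjoint]
          rcases exists_eq_mul_of_length_eq h with ⟨rfl, rfl⟩ | ⟨k, α, l, β, rfl, rfl, h'⟩
          · simpa [wordOp_one, wordOp_of] using hin (FreeMonoid.of i) (FreeMonoid.of j) m rfl
          · have key : star (S i) * (wordOp S (FreeMonoid.of k * α) * Z ^ m *
                  star (wordOp S (FreeMonoid.of l * β))) * S j
                = (star (S i) * S k) * (wordOp S α * Z ^ m * star (wordOp S β)) *
                  (star (S l) * S j) := by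
              simp only [wordOp_mul, wordOp_of, star_mul, mul_assoc]
            rw [key, horth, horth]
            have := hout α β m h'
            split_ifs <;> simp [this]
        · rw [← star_eq_adjoint]
          have key : star (S i) * (star (wordOp S α) * Z ^ m * wordOp S β) * S j
              = star (wordOp S (α * FreeMonoid.of i)) * Z ^ m *
                wordOp S (β * FreeMonoid.of j) := by
            simp only [wordOp_mul, wordOp_of, star_mul, mul_assoc]
          rw [key]
          exact hin _ _ m (by simpa using h))
      hx
  have hstable_out : ∀ x ∈ StarAlgebra.adjoin ℂ G, ∀ i j,
      S i * x * star (S j) ∈ StarAlgebra.adjoin ℂ G := fun x hx =>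
    mul_mul_star_mem_adjoin horth hone
      (by
        rintro g ((hg | ⟨α, β, m, h, rfl⟩) | ⟨α, β, m, h, rfl⟩) i j
        · exact hcpt _ ((IsCompactOperator.clm_comp hg (S i)).comp_clm (star (S j)))
        · rw [← star_eq_adjoint]
          have key : S i * (wordOp S α * Z ^ m * star (wordOp S β)) * star (S j)
              = wordOp S (FreeMonoid.of i * α) * Z ^ m *
                star (wordOp S (FreeMonoid.of j * β)) := by
            simp only [wordOp_mul, wordOp_of, star_mul, mul_assoc]
          rw [key]
          exact hout _ _ m (by simpa using h)
        · rw [← star_eq_adjoint]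
          rcases exists_eq_mul_of_length_eq' h with ⟨rfl, rfl⟩ | ⟨α, k, β, l, rfl, rfl, h'⟩
          · simpa [wordOp_one, wordOp_of] using hout (FreeMonoid.of i) (FreeMonoid.of j) m rfl
          · have key : S i * (star (wordOp S (α * FreeMonoid.of k)) * Z ^ m *
                  wordOp S (β * FreeMonoid.of l)) * star (S j)
                = (S i * star (S k)) * (star (wordOp S α) * Z ^ m * wordOp S β) *
                  (S l * star (S j)) := by
              simp only [wordOp_mul, wordOp_of, star_mul, mul_assoc]
            rw [key]
            exact mul_mem (mul_mem (hone i k) (hin α β m h')) (hone l j))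
      hx
  have hcomm : ∀ a : FockSpace d →L[ℂ] FockSpace d,
      a ∈ StarSubalgebra.centralizer ℂ (Set.range P) ↔ ∀ k, a * P k = P k * a := fun a => by
    simp [StarSubalgebra.mem_centralizer_iff, star_grading hP, eq_comm]
  set A := StarAlgebra.adjoin ℂ G ⊓ StarSubalgebra.centralizer ℂ (Set.range P)
  have hZA : Z ∈ A := ⟨by simpa [wordOp_one] using hin 1 1 1 rfl, (hcomm Z).2 hZP⟩
  rw [← SetLike.mem_coe, StarSubalgebra.topologicalClosure_coe, Metric.mem_closure_iff] at hXT ⊢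
  intro ε hε
  obtain ⟨Y, hY, hXY⟩ := hXT ε hε
  have hYspan := adjoin_range_mul_le_span (A := A) hZA ⟨0, hd⟩ (by simp [horth])
    (fun a ha i j => ⟨hstable_in a ha.1 i j,
      (hcomm _).2 (star_creation_mul_mul_commute hS hP ((hcomm a).1 ha.2) i j)⟩)
    (fun a ha i j => ⟨hstable_out a ha.1 i j,
      (hcomm _).2 (creation_mul_mul_star_commute hS hP ((hcomm a).1 ha.2) i j)⟩) hY
  obtain ⟨a, ha, hYa⟩ := exists_diagonal_part (A := A) (fun a ha => (hcomm a).1 ha.2)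
    (grading_mul_grading hP) (fun n => grading_succ_mul_creation hS hP n _)
    (grading_zero_mul_creation hS hP _) (star_grading hP) hYspan
  refine ⟨a, ha.1, lt_of_le_of_lt ?_ hXY⟩
  rw [dist_eq_norm, dist_eq_norm]
  refine norm_le_of_grading hP (fun k => ?_) (norm_nonneg _) fun k => ?_
  · rw [sub_mul, mul_sub, hXD, (hcomm a).1 ha.2]
  · have : P k * (X - a) * P k = P k * (X - Y) * P k := by
      rw [← sub_add_sub_cancel X Y a, mul_add, add_mul, hYa, add_zero]
    rw [this]
    calc ‖P k * (X - Y) * P k‖ ≤ ‖P k‖ * ‖X - Y‖ * ‖P k‖ :=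
          (norm_mul_le _ _).trans (by gcongr; exact norm_mul_le _ _)
      _ ≤ 1 * ‖X - Y‖ * 1 := by gcongr <;> exact norm_grading_le_one hP k
      _ = ‖X - Y‖ := by ring
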